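/- arXiv:2211.04015 — 9 statements merged into one kernel-verified Lean document; each statement's English description precedes it below -/
import Mathlib

section
/- The map X ↦ X̃ is a group homomorphism from GL₂(F₂) into GL₄(F₂); that is, for every X ∈ GL₂(F₂) the matrix X̃ is invertible, the identity matrix of GL₂(F₂) is sent to the identity matrix of GL₄(F₂), and (XY)̃ = X̃·Ỹ for all X, Y ∈ GL₂(F₂). -/
/-- The field with two elements. -/
abbrev F2 : Type := ZMod 2

/-- The two-dimensional `F2`-vector space. -/
abbrev V : Type := F2 × F2

/-- A two-dimensional algebra over `F2`: an `F2`-bilinear multiplication on `V`. -/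
abbrev Mul2 : Type := V →ₗ[F2] V →ₗ[F2] V

/-- The two-dimensional algebra over `F2` whose structure matrix (w.r.t. the standard
basis `e = (1,0)`, `f = (0,1)`) is `M`; the rows of `M` give `e²`, `f²`, `e·f`, `f·e`. -/
def mulOf (M : Matrix (Fin 4) (Fin 2) F2) : Mul2 :=
  LinearMap.mk₂ F2
    (fun x y =>
      (x.1 * y.1 * M 0 0 + x.2 * y.2 * M 1 0 + x.1 * y.2 * M 2 0 + x.2 * y.1 * M 3 0,
       x.1 * y.1 * M 0 1 + x.2 * y.2 * M 1 1 + x.1 * y.2 * M 2 1 + x.2 * y.1 * M 3 1))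
    (by intro m n p; simp [Prod.ext_iff]; constructor <;> ring)
    (by intro c m p; simp [Prod.ext_iff, smul_eq_mul]; constructor <;> ring)
    (by intro m n p; simp [Prod.ext_iff]; constructor <;> ring)
    (by intro c m p; simp [Prod.ext_iff, smul_eq_mul]; constructor <;> ring)

/-- The first standard basis vector. -/
def e : V := (1, 0)

/-- The second standard basis vector. -/
def f : V := (0, 1)

/-- The structure matrix of a two-dimensional algebra over `F2` w.r.t. the standard basis:
its rows are the coordinates of `e²`, `f²`, `e·f`, `f·e`. -/
def structMatrix (μ : Mul2) : Matrix (Fin 4) (Fin 2) F2 :=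
  ![![(μ e e).1, (μ e e).2],
    ![(μ f f).1, (μ f f).2],
    ![(μ e f).1, (μ e f).2],
    ![(μ f e).1, (μ f e).2]]

/-- Two two-dimensional algebras over `F2` are isomorphic: there is an `F2`-linear
bijection preserving multiplication. -/
def IsIso (μ μ' : Mul2) : Prop :=
  ∃ φ : V ≃ₗ[F2] V, ∀ x y : V, φ (μ x y) = μ' (φ x) (φ y)

/-- An algebra is endo-commutative if `(x·x)·(y·y) = (x·y)·(x·y)` for all `x, y`. -/
def EndoCommutative (μ : Mul2) : Prop :=
  ∀ x y : V, μ (μ x x) (μ y y) = μ (μ x y) (μ x y)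

/-- An algebra is curled if every square `x·x` is a scalar multiple of `x`. -/
def Curled (μ : Mul2) : Prop := ∀ x : V, ∃ lam : F2, μ x x = lam • x

/-- An algebra is commutative if `x·y = y·x` for all `x, y`. -/
def IsCommutative2 (μ : Mul2) : Prop := ∀ x y : V, μ x y = μ y x

/-- An algebra is associative if `(x·y)·z = x·(y·z)` for all `x, y, z`. -/
def IsAssociative2 (μ : Mul2) : Prop := ∀ x y z : V, μ (μ x y) z = μ x (μ y z)

/-- An algebra is unital if it has a two-sided unit. -/
def IsUnital2 (μ : Mul2) : Prop := ∃ u : V, ∀ x : V, μ u x = x ∧ μ x u = x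

/-- An algebra is zeropotent if `x·x = 0` for all `x`. -/
def Zeropotent (μ : Mul2) : Prop := ∀ x : V, μ x x = 0

/-- For `X = [[a,b],[c,d]]`, `tilde X` is the 4×4 matrix with rows
`(a,b,ab,ab)`, `(c,d,cd,cd)`, `(ac,bd,ad,bc)`, `(ac,bd,bc,ad)`. -/
def tilde (X : Matrix (Fin 2) (Fin 2) F2) : Matrix (Fin 4) (Fin 4) F2 :=
  ![![X 0 0, X 0 1, X 0 0 * X 0 1, X 0 0 * X 0 1],
    ![X 1 0, X 1 1, X 1 0 * X 1 1, X 1 0 * X 1 1],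
    ![X 0 0 * X 1 0, X 0 1 * X 1 1, X 0 0 * X 1 1, X 0 1 * X 1 0],
    ![X 0 0 * X 1 0, X 0 1 * X 1 1, X 0 1 * X 1 0, X 0 0 * X 1 1]]

/-- The curled-type algebra `C(a,b,c,d;ε,δ)`:
`e² = ε·e`, `f² = δ·f`, `e·f = a·e + b·f`, `f·e = c·e + d·f`. -/
def Calg (a b c d ε δ : F2) : Mul2 := mulOf ![![ε, 0], ![0, δ], ![a, b], ![c, d]]

/-- The straight-type algebra `S(p,q,a,b,c,d)`:
`e² = f`, `f² = p·e + q·f`, `e·f = a·e + b·f`, `f·e = c·e + d·f`. -/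
def Salg (p q a b c d : F2) : Mul2 := mulOf ![![0, 1], ![p, q], ![a, b], ![c, d]]

/-- The order `(0,0)`, `(1,1)`, `(0,1)`, `(1,0)` on pairs of indices, matching the products
`e²`, `f²`, `e·f`, `f·e`. -/
def tildeIndex : Fin 4 ≃ Fin 2 × Fin 2 where
  toFun := ![(0, 0), (1, 1), (0, 1), (1, 0)]
  invFun p := ![![0, 2], ![3, 1]] p.1 p.2
  left_inv := by decide
  right_inv := by decide

open scoped Kronecker in
/-- `tilde X` is the Kronecker square of `X`, with rows and columns indexed in the order
`(0,0)`, `(1,1)`, `(0,1)`, `(1,0)`. -/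
theorem tilde_eq_kronecker_submatrix (X : Matrix (Fin 2) (Fin 2) F2) :
    tilde X = (X ⊗ₖ X).submatrix tildeIndex tildeIndex := by
  have idem : ∀ a : F2, a * a = a := by decide
  ext i j
  fin_cases i <;> fin_cases j <;> simp [tilde, tildeIndex, idem, mul_comm]

theorem tilde_mul (X Y : Matrix (Fin 2) (Fin 2) F2) : tilde (X * Y) = tilde X * tilde Y := by
  simp only [tilde_eq_kronecker_submatrix, Matrix.mul_kronecker_mul, Matrix.submatrix_mul_equiv]

theorem tilde_one : tilde 1 = 1 := by
  rw [tilde_eq_kronecker_submatrix, Matrix.one_kronecker_one, Matrix.submatrix_one_equiv]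

/-- The map `X ↦ tilde X` is a group homomorphism from `GL₂(F₂)` into `GL₄(F₂)`:
`tilde X` is invertible for invertible `X`, the identity goes to the identity, and
`tilde` is multiplicative on invertible matrices. -/
theorem tilde_group_hom :
    (∀ X : Matrix (Fin 2) (Fin 2) F2, IsUnit X → IsUnit (tilde X)) ∧
    tilde (1 : Matrix (Fin 2) (Fin 2) F2) = (1 : Matrix (Fin 4) (Fin 4) F2) ∧
    (∀ X Y : Matrix (Fin 2) (Fin 2) F2, IsUnit X → IsUnit Y →
      tilde (X * Y) = tilde X * tilde Y) := by
  refine ⟨fun X hX => ?_, tilde_one, fun X Y _ _ => tilde_mul X Y⟩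
  exact hX.map (⟨⟨tilde, tilde_one⟩, tilde_mul⟩ :
    Matrix (Fin 2) (Fin 2) F2 →* Matrix (Fin 4) (Fin 4) F2)
end

section
/- Let A be the two-dimensional algebra over F₂ with structure matrix having rows (a1,b1),(a2,b2),(a3,b3),(a4,b4). Then A is endo-commutative if and only if the following eight equations hold in F₂: (1) a1a2+a2b1b2+a1a3b2+a2a4b1+a1a3+a2b3+a3b3+a3a4b3=0; (2) a1a2+a2b1b2+a2a3b1+a1a4b2+a1a4+a2b4+a3a4b4+a4b4=0; (3) a1a3+a1a4+a4b1+a2b1b3+a2b1b4+a1a3b4+a3b1+a1a4b3=0; (4) a1a2a4+a2a4b4+a2b2b4+a1a2a3+a2b2b3+a2a3b3=0; (5) a1a2b1+b1b2+a1b2b3+a2b1b4+a3b1+b2b3+a3b3+a3b3b4=0; (6) a1a2b1+b1b2+a2b1b3+a1b2b4+a4b1+b2b4+a4b3b4+a4b4=0; (7) a1a3b1+a1a4b1+a4b1b4+b1b2b3+b1b2b4+a3b1b3=0; (8) a2a3b1+a2a4b1+a4b2b3+b2b3+b2b4+a2b4+a2b3+a3b2b4=0. -/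
/-- The product with structure matrix `(a1,b1),(a2,b2),(a3,b3),(a4,b4)` on pairs over a
commutative ring. -/
def pairMul {R : Type*} [CommRing R] (a1 b1 a2 b2 a3 b3 a4 b4 : R) (x y : R × R) : R × R :=
  (x.1 * y.1 * a1 + x.2 * y.2 * a2 + x.1 * y.2 * a3 + x.2 * y.1 * a4,
   x.1 * y.1 * b1 + x.2 * y.2 * b2 + x.1 * y.2 * b3 + x.2 * y.1 * b4)

/-- Over a commutative ring of characteristic two in which every element is idempotent,
endo-commutativity of `pairMul` amounts to eight equations in the structure constants. -/
theorem pairMul_endoCommutative_iff {R : Type*} [CommRing R] [CharP R 2]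
    (sq : ∀ a : R, a * a = a) (a1 b1 a2 b2 a3 b3 a4 b4 : R) :
    (∀ x y : R × R,
      pairMul a1 b1 a2 b2 a3 b3 a4 b4 (pairMul a1 b1 a2 b2 a3 b3 a4 b4 x x)
          (pairMul a1 b1 a2 b2 a3 b3 a4 b4 y y) =
        pairMul a1 b1 a2 b2 a3 b3 a4 b4 (pairMul a1 b1 a2 b2 a3 b3 a4 b4 x y)
          (pairMul a1 b1 a2 b2 a3 b3 a4 b4 x y)) ↔
      (a1*a2 + a2*b1*b2 + a1*a3*b2 + a2*a4*b1 + a1*a3 + a2*b3 + a3*b3 + a3*a4*b3 = 0 ∧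
       a1*a2 + a2*b1*b2 + a2*a3*b1 + a1*a4*b2 + a1*a4 + a2*b4 + a3*a4*b4 + a4*b4 = 0 ∧
       a1*a3 + a1*a4 + a4*b1 + a2*b1*b3 + a2*b1*b4 + a1*a3*b4 + a3*b1 + a1*a4*b3 = 0 ∧
       a1*a2*a4 + a2*a4*b4 + a2*b2*b4 + a1*a2*a3 + a2*b2*b3 + a2*a3*b3 = 0 ∧
       a1*a2*b1 + b1*b2 + a1*b2*b3 + a2*b1*b4 + a3*b1 + b2*b3 + a3*b3 + a3*b3*b4 = 0 ∧
       a1*a2*b1 + b1*b2 + a2*b1*b3 + a1*b2*b4 + a4*b1 + b2*b4 + a4*b3*b4 + a4*b4 = 0 ∧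
       a1*a3*b1 + a1*a4*b1 + a4*b1*b4 + b1*b2*b3 + b1*b2*b4 + a3*b1*b3 = 0 ∧
       a2*a3*b1 + a2*a4*b1 + a4*b2*b3 + b2*b3 + b2*b4 + a2*b4 + a2*b3 + a3*b2*b4 = 0) := by
  simp only [pairMul, Prod.forall, Prod.mk.injEq]
  have ha1 := sq a1
  have hb1 := sq b1
  have ha2 := sq a2
  have hb2 := sq b2
  have ha3 := sq a3
  have hb3 := sq b3
  have ha4 := sq a4
  have hb4 := sq b4
  have two : (2 : R) = 0 := CharTwo.two_eq_zero
  constructor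
  · intro h
    obtain ⟨h1, h5⟩ := h 1 0 0 1
    obtain ⟨h2, h6⟩ := h 0 1 1 0
    obtain ⟨h3, h7⟩ := h 1 0 1 1
    obtain ⟨h4, h8⟩ := h 0 1 1 1
    simp only [mul_zero, zero_mul, mul_one, one_mul, add_zero, zero_add] at h1 h2 h3 h4 h5 h6 h7 h8
    refine ⟨?_, ?_, ?_, ?_, ?_, ?_, ?_, ?_⟩
    · linear_combination
        h1 - a2 * ha1 + a1 * ha3 + a2 * hb3 + b3 * ha3 +
          (a1 * a3 + a2 * b3 + a3 * b3 + a3 * a4 * b3) * two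
    · linear_combination
        h2 - a2 * ha1 + a1 * ha4 + a2 * hb4 + b4 * ha4 +
          (a1 * a4 + a2 * b4 + a3 * a4 * b4 + a4 * b4) * two
    · linear_combination
        h3 - h1 - a4 * ha1 - b1 * ha4 + a3 * ha1 + b1 * ha3 +
          (a1 * a3 + a2 * b1 * b3 + a3 * b1 + a1 * a4 * b3) * two
    · linear_combination
        h4 - h2 + (a1 * a2 * a4 + a2 * b2 * b4 + a2 * a4 * b4) * two
    · linear_combination
        h5 - b1 * hb2 + b1 * ha3 + b2 * hb3 + a3 * hb3 +
          (a3 * b1 + b2 * b3 + a3 * b3 + a3 * b3 * b4) * two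
    · linear_combination
        h6 - b1 * hb2 + b1 * ha4 + b2 * hb4 + a4 * hb4 +
          (a4 * b1 + b2 * b4 + a4 * b3 * b4 + a4 * b4) * two
    · linear_combination
        h7 - h5 + (a1 * a3 * b1 + b1 * b2 * b3 + a3 * b1 * b3) * two
    · linear_combination
        h8 - h6 - b3 * hb2 - a2 * hb3 + b4 * hb2 + a2 * hb4 +
          (a2 * a4 * b1 + b2 * b4 + a4 * b2 * b3 + a2 * b4) * two
  · rintro ⟨h1, h2, h3, h4, h5, h6, h7, h8⟩ x1 x2 y1 y2
    have hx1 := sq x1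
    have hx2 := sq x2
    have hy1 := sq y1
    have hy2 := sq y2
    clear sq
    constructor
    · linear_combination (norm := skip)
        (x1 * y2 + x1 * x2 * y1 * y2) * h1 + (x2 * y1 + x1 * x2 * y1 * y2) * h2 +
          (x1 * x2 * y1 + x1 * y1 * y2) * h3 + (x1 * x2 * y2 + x2 * y1 * y2) * h4
      clear h1 h2 h3 h4 h5 h6 h7 h8
      grind
    · linear_combination (norm := skip)
        (x1 * y2 + x1 * x2 * y1 * y2) * h5 + (x2 * y1 + x1 * x2 * y1 * y2) * h6 +
          (x1 * x2 * y1 + x1 * y1 * y2) * h7 + (x1 * x2 * y2 + x2 * y1 * y2) * h8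
      clear h1 h2 h3 h4 h5 h6 h7 h8
      grind

/-- The algebra with structure matrix rows `(a1,b1),(a2,b2),(a3,b3),(a4,b4)` is
endo-commutative iff the eight listed equations hold in `F₂`. -/
theorem endoCommutative_iff_structMatrix_eqs (a1 b1 a2 b2 a3 b3 a4 b4 : F2) :
    EndoCommutative (mulOf ![![a1, b1], ![a2, b2], ![a3, b3], ![a4, b4]]) ↔
      (a1*a2 + a2*b1*b2 + a1*a3*b2 + a2*a4*b1 + a1*a3 + a2*b3 + a3*b3 + a3*a4*b3 = 0 ∧
       a1*a2 + a2*b1*b2 + a2*a3*b1 + a1*a4*b2 + a1*a4 + a2*b4 + a3*a4*b4 + a4*b4 = 0 ∧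
       a1*a3 + a1*a4 + a4*b1 + a2*b1*b3 + a2*b1*b4 + a1*a3*b4 + a3*b1 + a1*a4*b3 = 0 ∧
       a1*a2*a4 + a2*a4*b4 + a2*b2*b4 + a1*a2*a3 + a2*b2*b3 + a2*a3*b3 = 0 ∧
       a1*a2*b1 + b1*b2 + a1*b2*b3 + a2*b1*b4 + a3*b1 + b2*b3 + a3*b3 + a3*b3*b4 = 0 ∧
       a1*a2*b1 + b1*b2 + a2*b1*b3 + a1*b2*b4 + a4*b1 + b2*b4 + a4*b3*b4 + a4*b4 = 0 ∧
       a1*a3*b1 + a1*a4*b1 + a4*b1*b4 + b1*b2*b3 + b1*b2*b4 + a3*b1*b3 = 0 ∧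
       a2*a3*b1 + a2*a4*b1 + a4*b2*b3 + b2*b3 + b2*b4 + a2*b4 + a2*b3 + a3*b2*b4 = 0) := by
  exact pairMul_endoCommutative_iff (by decide) a1 b1 a2 b2 a3 b3 a4 b4
end

section
/- For a,b,c,d,ε,δ ∈ F₂, the algebra C(a,b,c,d;ε,δ) is curled if and only if ε+a+c = δ+b+d holds in F₂. -/
/-- The square of `(x, y)` in `C(a,b,c,d;ε,δ)`. -/
lemma Calg_self_apply (a b c d ε δ x y : F2) :
    Calg a b c d ε δ (x, y) (x, y) =
      (x * x * ε + x * y * a + y * x * c, y * y * δ + x * y * b + y * x * d) := by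
  simp [Calg, mulOf]

/-- `C(a,b,c,d;ε,δ)` is curled iff `ε + a + c = δ + b + d`. -/
theorem Calg_curled_iff (a b c d ε δ : F2) :
    Curled (Calg a b c d ε δ) ↔ ε + a + c = δ + b + d := by
  constructor
  · intro h
    obtain ⟨lam, h⟩ := h (1, 1)
    simp only [Calg_self_apply, Prod.smul_mk, Prod.mk.injEq, smul_eq_mul, one_mul, mul_one] at h
    exact h.1.trans h.2.symm
  · rintro h ⟨x, y⟩
    have zero_or_one : ∀ z : F2, z = 0 ∨ z = 1 := by decide
    rcases zero_or_one x with rfl | rfl <;> rcases zero_or_one y with rfl | rfl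
    · exact ⟨0, by simp [Calg_self_apply]⟩
    · exact ⟨δ, by simp [Calg_self_apply]⟩
    · exact ⟨ε, by simp [Calg_self_apply]⟩
    · exact ⟨ε + a + c, by simp [Calg_self_apply, h]⟩
end

section
/- For a,b,c,d,ε,δ ∈ F₂, the algebra C(a,b,c,d;ε,δ) is endo-commutative and curled if and only if the following seven equations hold in F₂: ε+δ+a+b+c+d=0; a(εδ+ε+b+bc)=0; c(εδ+ε+ad+d)=0; ε(a+c+ad+bc)=0; b(εδ+δ+a+ad)=0; d(εδ+δ+bc+c)=0; δ(bc+b+d+ad)=0. -/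
lemma Calg_apply (a b c d ε δ : F2) (x y : V) :
    Calg a b c d ε δ x y =
      (x.1 * y.1 * ε + x.1 * y.2 * a + x.2 * y.1 * c,
       x.2 * y.2 * δ + x.1 * y.2 * b + x.2 * y.1 * d) := by
  simp [Calg, mulOf]

/-- `C(a,b,c,d;ε,δ)` is endo-commutative and curled iff the seven listed equations
hold in `F₂`. -/
theorem Calg_endoCommutative_and_curled_iff (a b c d ε δ : F2) :
    (EndoCommutative (Calg a b c d ε δ) ∧ Curled (Calg a b c d ε δ)) ↔
      (ε + δ + a + b + c + d = 0 ∧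
       a * (ε * δ + ε + b + b * c) = 0 ∧
       c * (ε * δ + ε + a * d + d) = 0 ∧
       ε * (a + c + a * d + b * c) = 0 ∧
       b * (ε * δ + δ + a + a * d) = 0 ∧
       d * (ε * δ + δ + b * c + c) = 0 ∧
       δ * (b * c + b + d + a * d) = 0) := by
  simp only [EndoCommutative, Curled, Calg_apply]
  revert a b c d ε δ
  decide +kernel
end

section
/- Each of the following twenty algebras is endo-commutative and curled: C(0,0,0,0;0,0), C(0,1,0,1;0,0), C(1,0,1,0;0,0), C(1,1,1,1;0,0), C(0,1,1,0;0,0), C(1,0,0,1;0,0), C(0,1,0,0;1,0), C(1,1,0,1;1,0), C(0,1,1,1;1,0), C(0,0,0,1;1,0), C(1,1,1,0;0,1), C(1,0,1,1;0,1), C(0,0,1,0;0,1), C(1,0,0,0;0,1), C(0,0,0,0;1,1), C(0,1,0,1;1,1), C(1,0,1,0;1,1), C(1,1,1,1;1,1), C(0,1,1,0;1,1), C(1,0,0,1;1,1). Conversely, every endo-commutative curled two-dimensional algebra over F₂ is isomorphic to one of these twenty algebras. -/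
/-- `C` applied to a 6-tuple of parameters `(a,b,c,d,ε,δ)`. -/
def CalgT (t : F2 × F2 × F2 × F2 × F2 × F2) : Mul2 :=
  Calg t.1 t.2.1 t.2.2.1 t.2.2.2.1 t.2.2.2.2.1 t.2.2.2.2.2

/-- The twenty parameter tuples `(a,b,c,d,ε,δ)` of the listed algebras `C(a,b,c,d;ε,δ)`. -/
def eccList : List (F2 × F2 × F2 × F2 × F2 × F2) :=
  [(0, 0, 0, 0, 0, 0),
   (0, 1, 0, 1, 0, 0),
   (1, 0, 1, 0, 0, 0),
   (1, 1, 1, 1, 0, 0),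
   (0, 1, 1, 0, 0, 0),
   (1, 0, 0, 1, 0, 0),
   (0, 1, 0, 0, 1, 0),
   (1, 1, 0, 1, 1, 0),
   (0, 1, 1, 1, 1, 0),
   (0, 0, 0, 1, 1, 0),
   (1, 1, 1, 0, 0, 1),
   (1, 0, 1, 1, 0, 1),
   (0, 0, 1, 0, 0, 1),
   (1, 0, 0, 0, 0, 1),
   (0, 0, 0, 0, 1, 1),
   (0, 1, 0, 1, 1, 1),
   (1, 0, 1, 0, 1, 1),
   (1, 1, 1, 1, 1, 1),
   (0, 1, 1, 0, 1, 1),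
   (1, 0, 0, 1, 1, 1)]

/-- Every curled algebra is one of the algebras `C(a,b,c,d;ε,δ)`. -/
lemma Curled.exists_eq_calgT {μ : Mul2} (h : Curled μ) : ∃ t, μ = CalgT t := by
  obtain ⟨ε, hε⟩ := h e
  obtain ⟨δ, hδ⟩ := h f
  refine ⟨((μ e f).1, (μ e f).2, (μ f e).1, (μ f e).2, ε, δ), LinearMap.ext₂ fun x y => ?_⟩
  have basis_expansion (v : V) : v = v.1 • e + v.2 • f := by simp [e, f]
  rw [basis_expansion x, basis_expansion y]
  simp only [map_add, map_smul, LinearMap.add_apply, LinearMap.smul_apply, hε, hδ]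
  simp [CalgT, Calg, mulOf, e, f]

instance (μ : Mul2) : Decidable (EndoCommutative μ) :=
  inferInstanceAs (Decidable (∀ x y : V, μ (μ x x) (μ y y) = μ (μ x y) (μ x y)))

instance (μ : Mul2) : Decidable (Curled μ) :=
  inferInstanceAs (Decidable (∀ x : V, ∃ lam : F2, μ x x = lam • x))

/-- The parameters of the endo-commutative curled algebras are exactly the listed ones. -/
lemma mem_eccList_iff :
    ∀ t, t ∈ eccList ↔ EndoCommutative (CalgT t) ∧ Curled (CalgT t) := by
  decide +kernel

/-- All twenty listed algebras are endo-commutative and curled, and every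
endo-commutative curled two-dimensional algebra over `F₂` is isomorphic to one of them. -/
theorem ecCurled_classification_list :
    (∀ t ∈ eccList, EndoCommutative (CalgT t) ∧ Curled (CalgT t)) ∧
    (∀ μ : Mul2, EndoCommutative μ → Curled μ → ∃ t ∈ eccList, IsIso μ (CalgT t)) := by
  refine ⟨fun t => (mem_eccList_iff t).1, fun μ hμ hc => ?_⟩
  obtain ⟨t, rfl⟩ := hc.exists_eq_calgT
  exact ⟨t, (mem_eccList_iff t).2 ⟨hμ, hc⟩, LinearEquiv.refl F2 V, fun _ _ => rfl⟩
end

section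
/- Let A be a two-dimensional curled algebra over F₂. If A is unital, commutative or associative, then A is endo-commutative. -/
/-- In a curled algebra every element is square-zero or idempotent. -/
lemma Curled.sq_eq_zero_or_self {μ : Mul2} (hc : Curled μ) (x : V) :
    μ x x = 0 ∨ μ x x = x := by
  obtain ⟨c, hx⟩ := hc x
  obtain rfl | rfl : c = 0 ∨ c = 1 := by clear hx; decide +revert
  · exact .inl (by simpa using hx)
  · exact .inr (by simpa using hx)

lemma endoCommutative_of_forall_sq_eq_self {μ : Mul2} (h : ∀ x, μ x x = x) :
    EndoCommutative μ := fun x y => by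
  rw [h x, h y, h (μ x y)]

lemma Curled.endoCommutative_of_isUnital {μ : Mul2} (hc : Curled μ) (h : IsUnital2 μ) :
    EndoCommutative μ := by
  obtain ⟨u, hu⟩ := h
  refine endoCommutative_of_forall_sq_eq_self fun y => ?_
  rcases hc.sq_eq_zero_or_self y with hy | hy
  · have hsq : μ (u + y) (u + y) = u := by
      simp [(hu u).1, (hu y).1, (hu y).2, hy, add_assoc, ZModModule.add_self]
    have hy0 : y = 0 := by
      rcases hc.sq_eq_zero_or_self (u + y) with h0 | h0 <;> rw [hsq] at h0
      · simpa [h0] using (hu y).1.symm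
      · simpa using h0
    simp [hy0]
  · exact hy

/-- A commutative curled algebra cannot have both a nonzero square-zero element and a nonzero
idempotent. -/
lemma Curled.eq_zero_or_eq_zero_of_isCommutative {μ : Mul2} (hc : Curled μ)
    (h : IsCommutative2 μ) {x y : V} (hx : μ x x = 0) (hy : μ y y = y) : x = 0 ∨ y = 0 := by
  have hsq : μ (x + y) (x + y) = y := by
    simp [hx, hy, h y x, ← add_assoc, ZModModule.add_self]
  rcases hc.sq_eq_zero_or_self (x + y) with h0 | h0 <;> rw [hsq] at h0
  · exact .inr h0
  · exact .inl (by simpa using h0)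

lemma Curled.endoCommutative_of_isCommutative {μ : Mul2} (hc : Curled μ)
    (h : IsCommutative2 μ) : EndoCommutative μ := by
  intro x y
  rcases hc.sq_eq_zero_or_self (μ x y) with hz | hz
  · rcases hc.sq_eq_zero_or_self x with hx | hx
    · simp [hx, hz]
    rcases hc.sq_eq_zero_or_self y with hy | hy
    · simp [hy, hz]
    rcases hc.eq_zero_or_eq_zero_of_isCommutative h hz hx with h0 | h0 <;> simp [hx, hy, h0]
  · rcases hc.sq_eq_zero_or_self x with hx | hx
    · rcases hc.eq_zero_or_eq_zero_of_isCommutative h hx hz with h0 | h0 <;> simp [hx, h0]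
    rcases hc.sq_eq_zero_or_self y with hy | hy
    · rcases hc.eq_zero_or_eq_zero_of_isCommutative h hy hz with h0 | h0 <;> simp [hy, h0]
    rw [hx, hy, hz]

/-- Two distinct nonzero vectors of `V` span it. -/
lemma eq_zero_or_eq_or_eq_or_eq_add {x y : V} (hx : x ≠ 0) (hy : y ≠ 0) (hxy : x ≠ y) (z : V) :
    z = 0 ∨ z = x ∨ z = y ∨ z = x + y := by
  revert x y z
  decide

lemma Curled.endoCommutative_of_isAssociative {μ : Mul2} (hc : Curled μ)
    (h : IsAssociative2 μ) : EndoCommutative μ := by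
  intro x y
  by_cases hx0 : x = 0
  · simp [hx0]
  by_cases hy0 : y = 0
  · simp [hy0]
  by_cases hxy : x = y
  · rw [hxy]
  have hl : μ x (μ x y) = μ (μ x x) y := (h x x y).symm
  have hr : μ (μ x y) y = μ x (μ y y) := h x y y
  rcases eq_zero_or_eq_or_eq_or_eq_add hx0 hy0 hxy (μ x y) with hz | hz | hz | hz <;>
    rcases hc.sq_eq_zero_or_self x with hx | hx <;>
    rcases hc.sq_eq_zero_or_self y with hy | hy <;>
    simp_all

/-- A two-dimensional curled algebra over `F₂` which is unital, commutative or
associative is endo-commutative. -/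
theorem curled_special_implies_endoCommutative (μ : Mul2) (hc : Curled μ)
    (h : IsUnital2 μ ∨ IsCommutative2 μ ∨ IsAssociative2 μ) :
    EndoCommutative μ := by
  rcases h with h | h | h
  · exact hc.endoCommutative_of_isUnital h
  · exact hc.endoCommutative_of_isCommutative h
  · exact hc.endoCommutative_of_isAssociative h
end

section
/- Up to isomorphism, the two-dimensional endo-commutative curled algebras over F₂ are exactly the following eight pairwise non-isomorphic algebras, given on a basis {e,f} by: ECC²₀ with e²=f²=ef=fe=0; ECC²₁ with e²=f²=0, ef=fe=f; ECC²₂ with e²=f²=0, ef=f, fe=e; ECC²₃ with e²=f²=0, ef=e, fe=f; ECC²₄ with e²=e, f²=0, ef=f, fe=0; ECC²₅ with e²=e, f²=0, ef=0, fe=f; ECC²₆ with e²=e, f²=f, ef=fe=0; ECC²₇ with e²=e, f²=f, ef=fe=e+f. That is, every two-dimensional endo-commutative curled algebra over F₂ is isomorphic to one of these eight algebras, and no two of these eight algebras are isomorphic. -/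
/-- The eight representative endo-commutative curled algebras `ECC²₀, …, ECC²₇`;
rows of each structure matrix give `e²`, `f²`, `e·f`, `f·e`. -/
def ECC : Fin 8 → Mul2 :=
  ![mulOf ![![0, 0], ![0, 0], ![0, 0], ![0, 0]],
    mulOf ![![0, 0], ![0, 0], ![0, 1], ![0, 1]],
    mulOf ![![0, 0], ![0, 0], ![0, 1], ![1, 0]],
    mulOf ![![0, 0], ![0, 0], ![1, 0], ![0, 1]],
    mulOf ![![1, 0], ![0, 0], ![0, 1], ![0, 0]],
    mulOf ![![1, 0], ![0, 0], ![0, 0], ![0, 1]],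
    mulOf ![![1, 0], ![0, 1], ![0, 0], ![0, 0]],
    mulOf ![![1, 0], ![0, 1], ![1, 1], ![1, 1]]]

theorem mul2_apply (μ : Mul2) (x y : V) :
    μ x y = (x.1 * y.1) • μ e e + (x.2 * y.2) • μ f f + (x.1 * y.2) • μ e f
      + (x.2 * y.1) • μ f e := by
  have h (z : V) : z = z.1 • e + z.2 • f := by ext <;> simp [e, f]
  conv_lhs => rw [h x, h y]
  simp only [map_add, map_smul, LinearMap.add_apply, LinearMap.smul_apply]
  module

theorem mulOf_structMatrix (μ : Mul2) : mulOf (structMatrix μ) = μ := by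
  refine LinearMap.ext₂ fun x y => ?_
  rw [mul2_apply μ x y]
  simp [mulOf, structMatrix, Prod.ext_iff]

theorem Curled.exists_eq_Calg {μ : Mul2} (h : Curled μ) :
    ∃ a b c d ε δ : F2, μ = Calg a b c d ε δ := by
  obtain ⟨ε, hε⟩ := h e
  obtain ⟨δ, hδ⟩ := h f
  refine ⟨(μ e f).1, (μ e f).2, (μ f e).1, (μ f e).2, ε, δ, ?_⟩
  refine (mulOf_structMatrix μ).symm.trans (congrArg mulOf ?_)
  rw [structMatrix, hε, hδ]
  simp only [e, f, Prod.smul_mk, smul_eq_mul, mul_one, mul_zero]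
  rfl

/-- The unimodular pair `(u, v)` is the image of `(e, f)` under an isomorphism from `μ` to `ν`. -/
def IsIsoBasis (μ ν : Mul2) (u v : V) : Prop :=
  u.1 * v.2 + u.2 * v.1 = 1 ∧
    (μ e e).1 • u + (μ e e).2 • v = ν u u ∧ (μ f f).1 • u + (μ f f).2 • v = ν v v ∧
    (μ e f).1 • u + (μ e f).2 • v = ν u v ∧ (μ f e).1 • u + (μ f e).2 • v = ν v u

instance (μ ν : Mul2) (u v : V) : Decidable (IsIsoBasis μ ν u v) := by
  unfold IsIsoBasis; infer_instance

theorem isIso_iff_exists_isIsoBasis (μ ν : Mul2) : IsIso μ ν ↔ ∃ u v, IsIsoBasis μ ν u v := by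
  constructor
  · rintro ⟨φ, hφ⟩
    have h (z : V) : φ z = z.1 • φ e + z.2 • φ f := by
      rw [← map_smul, ← map_smul, ← map_add]
      congr 1
      ext <;> simp [e, f]
    refine ⟨φ e, φ f, ?_, ?_, ?_, ?_, ?_⟩
    · have key : ∀ u v : V, (∀ x y : V, x.1 • u + x.2 • v = y.1 • u + y.2 • v → x = y) →
          u.1 * v.2 + u.2 * v.1 = 1 := by decide
      refine key _ _ fun x y hxy => φ.injective ?_
      rw [h x, h y, hxy]
    all_goals rw [← h, hφ]
  · rintro ⟨u, v, hdet, hee, hff, hef, hfe⟩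
    let φ : V →ₗ[F2] V :=
      (LinearMap.fst F2 F2 F2).smulRight u + (LinearMap.snd F2 F2 F2).smulRight v
    have hinj : Function.Injective φ := by
      have key : ∀ u v : V, u.1 * v.2 + u.2 * v.1 = 1 →
          ∀ x y : V, x.1 • u + x.2 • v = y.1 • u + y.2 • v → x = y := by decide
      exact fun x y => key u v hdet x y
    refine ⟨LinearEquiv.ofInjectiveEndo φ hinj, fun x y => ?_⟩
    have hφ (z : V) : φ z = z.1 • u + z.2 • v := rfl
    simp only [LinearEquiv.coe_ofInjectiveEndo]
    rw [mul2_apply μ x y]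
    simp only [map_add, map_smul]
    simp only [hφ, hee, hff, hef, hfe]
    simp only [map_add, map_smul, LinearMap.add_apply, LinearMap.smul_apply]
    module

instance inst_s12 (μ : Mul2) : Decidable (EndoCommutative μ) := by
  unfold EndoCommutative; infer_instance

instance inst_s12_2 (μ : Mul2) : Decidable (Curled μ) := by
  unfold Curled; infer_instance

theorem endoCommutative_and_curled_ECC :
    ∀ i : Fin 8, EndoCommutative (ECC i) ∧ Curled (ECC i) := by
  decide +kernel

theorem exists_isIsoBasis_Calg_ECC : ∀ a b c d ε δ : F2, EndoCommutative (Calg a b c d ε δ) →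
    Curled (Calg a b c d ε δ) → ∃ i u v, IsIsoBasis (Calg a b c d ε δ) (ECC i) u v := by
  decide +kernel

theorem not_isIsoBasis_ECC_of_ne :
    ∀ i j : Fin 8, i ≠ j → ¬ ∃ u v, IsIsoBasis (ECC i) (ECC j) u v := by
  decide +kernel

/-- Classification: the eight algebras `ECC²₀, …, ECC²₇` are endo-commutative and
curled, every two-dimensional endo-commutative curled algebra over `F₂` is isomorphic
to one of them, and no two of them are isomorphic. -/
theorem ecCurled_classification :
    (∀ i : Fin 8, EndoCommutative (ECC i) ∧ Curled (ECC i)) ∧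
    (∀ μ : Mul2, EndoCommutative μ → Curled μ → ∃ i : Fin 8, IsIso μ (ECC i)) ∧
    (∀ i j : Fin 8, i ≠ j → ¬ IsIso (ECC i) (ECC j)) := by
  simp only [isIso_iff_exists_isIsoBasis]
  refine ⟨endoCommutative_and_curled_ECC, fun μ hec hc => ?_, not_isIsoBasis_ECC_of_ne⟩
  obtain ⟨a, b, c, d, ε, δ, rfl⟩ := hc.exists_eq_Calg
  exact exists_isIsoBasis_Calg_ECC a b c d ε δ hec hc
end

section
/- For p,q,a,b,c,d ∈ F₂, the algebra S(p,q,a,b,c,d) is endo-commutative if and only if (p,q,a,b,c,d) is one of the following thirteen tuples: (0,0,0,0,0,1), (0,0,0,1,0,0), (0,1,1,1,1,0), (0,1,1,0,1,1), (1,1,1,0,1,0), (1,0,0,0,0,0), (1,0,1,1,1,1), (0,0,0,0,0,0), (0,0,0,1,0,1), (0,1,0,1,0,1), (0,1,1,0,1,0), (1,0,0,1,1,0), (1,0,1,0,0,1). -/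
/-- The product in `S(p,q,a,b,c,d)` in coordinates. -/
def SalgMul (p q a b c d : F2) (x y : V) : V :=
  (x.2 * y.2 * p + x.1 * y.2 * a + x.2 * y.1 * c,
   x.1 * y.1 + x.2 * y.2 * q + x.1 * y.2 * b + x.2 * y.1 * d)

lemma Salg_apply (p q a b c d : F2) (x y : V) :
    Salg p q a b c d x y = SalgMul p q a b c d x y := by
  simp [Salg, mulOf, SalgMul]

/-- `S(p,q,a,b,c,d)` is endo-commutative iff `(p,q,a,b,c,d)` is one of the thirteen
listed tuples. -/
theorem Salg_endoCommutative_iff (p q a b c d : F2) :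
    EndoCommutative (Salg p q a b c d) ↔
      (((p, q, a, b, c, d) : F2 × F2 × F2 × F2 × F2 × F2) = (0, 0, 0, 0, 0, 1) ∨
       ((p, q, a, b, c, d) : F2 × F2 × F2 × F2 × F2 × F2) = (0, 0, 0, 1, 0, 0) ∨
       ((p, q, a, b, c, d) : F2 × F2 × F2 × F2 × F2 × F2) = (0, 1, 1, 1, 1, 0) ∨
       ((p, q, a, b, c, d) : F2 × F2 × F2 × F2 × F2 × F2) = (0, 1, 1, 0, 1, 1) ∨
       ((p, q, a, b, c, d) : F2 × F2 × F2 × F2 × F2 × F2) = (1, 1, 1, 0, 1, 0) ∨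
       ((p, q, a, b, c, d) : F2 × F2 × F2 × F2 × F2 × F2) = (1, 0, 0, 0, 0, 0) ∨
       ((p, q, a, b, c, d) : F2 × F2 × F2 × F2 × F2 × F2) = (1, 0, 1, 1, 1, 1) ∨
       ((p, q, a, b, c, d) : F2 × F2 × F2 × F2 × F2 × F2) = (0, 0, 0, 0, 0, 0) ∨
       ((p, q, a, b, c, d) : F2 × F2 × F2 × F2 × F2 × F2) = (0, 0, 0, 1, 0, 1) ∨
       ((p, q, a, b, c, d) : F2 × F2 × F2 × F2 × F2 × F2) = (0, 1, 0, 1, 0, 1) ∨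
       ((p, q, a, b, c, d) : F2 × F2 × F2 × F2 × F2 × F2) = (0, 1, 1, 0, 1, 0) ∨
       ((p, q, a, b, c, d) : F2 × F2 × F2 × F2 × F2 × F2) = (1, 0, 0, 1, 1, 0) ∨
       ((p, q, a, b, c, d) : F2 × F2 × F2 × F2 × F2 × F2) = (1, 0, 1, 0, 0, 1)) := by
  simp only [EndoCommutative, Salg_apply]
  revert p q a b c d
  set_option synthInstance.maxHeartbeats 400000 in
  set_option synthInstance.maxSize 2048 in
  decide +kernel
end

section
/- Up to isomorphism, the two-dimensional endo-commutative straight algebras over F₂ are exactly the following thirteen pairwise non-isomorphic algebras S(p,q,a,b,c,d) with (p,q,a,b,c,d) equal to: (0,0,0,0,0,1), (0,0,0,1,0,0), (0,1,1,1,1,0), (0,1,1,0,1,1), (1,1,1,0,1,0), (1,0,0,0,0,0), (1,0,1,1,1,1), (0,0,0,0,0,0), (0,0,0,1,0,1), (0,1,0,1,0,1), (0,1,1,0,1,0), (1,0,0,1,1,0), (1,0,1,0,0,1). That is, every two-dimensional endo-commutative straight algebra over F₂ is isomorphic to one of these thirteen algebras, and no two of these thirteen algebras are isomorphic. -/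
/-- `S` applied to a 6-tuple of parameters `(p,q,a,b,c,d)`. -/
def SalgT (t : F2 × F2 × F2 × F2 × F2 × F2) : Mul2 :=
  Salg t.1 t.2.1 t.2.2.1 t.2.2.2.1 t.2.2.2.2.1 t.2.2.2.2.2

/-- The thirteen parameter tuples `(p,q,a,b,c,d)` of the representative
endo-commutative straight algebras. -/
def ecsList : List (F2 × F2 × F2 × F2 × F2 × F2) :=
  [(0, 0, 0, 0, 0, 1),
   (0, 0, 0, 1, 0, 0),
   (0, 1, 1, 1, 1, 0),
   (0, 1, 1, 0, 1, 1),
   (1, 1, 1, 0, 1, 0),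
   (1, 0, 0, 0, 0, 0),
   (1, 0, 1, 1, 1, 1),
   (0, 0, 0, 0, 0, 0),
   (0, 0, 0, 1, 0, 1),
   (0, 1, 0, 1, 0, 1),
   (0, 1, 1, 0, 1, 0),
   (1, 0, 0, 1, 1, 0),
   (1, 0, 1, 0, 0, 1)]

theorem IsIso.symm {μ ν : Mul2} : IsIso μ ν → IsIso ν μ := fun ⟨φ, h⟩ =>
  ⟨φ.symm, fun x y => φ.injective (by simp [h])⟩

theorem IsIso.trans {μ ν ρ : Mul2} : IsIso μ ν → IsIso ν ρ → IsIso μ ρ :=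
  fun ⟨φ, h⟩ ⟨ψ, k⟩ => ⟨φ.trans ψ, fun x y => by simp [h, k]⟩

theorem IsIso.endoCommutative {μ ν : Mul2} (hμν : IsIso μ ν) (hν : EndoCommutative ν) :
    EndoCommutative μ := by
  obtain ⟨φ, h⟩ := hμν
  exact fun x y => φ.injective (by simpa [h] using hν (φ x) (φ y))

/-- `u` and `u·u` form a basis of `V` in which `μ` has the structure constants `t` of `SalgT t`. -/
def IsStraightGenerator (t : F2 × F2 × F2 × F2 × F2 × F2) (μ : Mul2) (u : V) : Prop :=
  μ u u ≠ 0 ∧ μ u u ≠ u ∧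
    μ (μ u u) (μ u u) = t.1 • u + t.2.1 • μ u u ∧
    μ u (μ u u) = t.2.2.1 • u + t.2.2.2.1 • μ u u ∧
    μ (μ u u) u = t.2.2.2.2.1 • u + t.2.2.2.2.2 • μ u u

theorem bijective_combination_of_ne {u v : V} (hu : u ≠ 0) (hv : v ≠ 0) (hvu : v ≠ u) :
    Function.Bijective fun x : V => x.1 • u + x.2 • v := by
  revert u v
  decide +kernel

/-- The multiplication of `SalgT t` in coordinates. -/
def straightMul (t : F2 × F2 × F2 × F2 × F2 × F2) (x y : V) : V :=
  (x.2 * y.2 * t.1 + x.1 * y.2 * t.2.2.1 + x.2 * y.1 * t.2.2.2.2.1,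
   x.1 * y.1 + x.2 * y.2 * t.2.1 + x.1 * y.2 * t.2.2.2.1 + x.2 * y.1 * t.2.2.2.2.2)

theorem salgT_apply (t : F2 × F2 × F2 × F2 × F2 × F2) (x y : V) :
    SalgT t x y = straightMul t x y := by
  simp [SalgT, Salg, mulOf, straightMul]

theorem isIso_salgT_iff (t : F2 × F2 × F2 × F2 × F2 × F2) (μ : Mul2) :
    IsIso (SalgT t) μ ↔ ∃ u, IsStraightGenerator t μ u := by
  constructor
  · rintro ⟨φ, h⟩
    have hφ (x : V) : φ x = x.1 • φ e + x.2 • φ f := by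
      rw [← map_smul, ← map_smul, ← map_add]
      congr 1
      simp [e, f]
    have hf : μ (φ e) (φ e) = φ f := by
      rw [← h, salgT_apply]
      simp [straightMul, e, f]
    refine ⟨φ e, ?_⟩
    unfold IsStraightGenerator
    rw [hf]
    refine ⟨by simp [f], fun H => by simpa [e, f] using φ.injective H, ?_, ?_, ?_⟩ <;>
      · rw [← h, hφ, salgT_apply]
        simp [straightMul, e, f]
  · rintro ⟨u, h0, hu, hvv, huv, hvu⟩
    have hu0 : u ≠ 0 := by rintro rfl; simp at h0
    let φ : V →ₗ[F2] V :=
      (LinearMap.fst F2 F2 F2).smulRight u + (LinearMap.snd F2 F2 F2).smulRight (μ u u)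
    have hφ (x : V) : φ x = x.1 • u + x.2 • μ u u := rfl
    refine ⟨LinearEquiv.ofBijective φ (bijective_combination_of_ne hu0 h0 hu), fun x y => ?_⟩
    change φ _ = μ (φ x) (φ y)
    simp only [hφ, salgT_apply, straightMul, map_add, map_smul,
      LinearMap.add_apply, LinearMap.smul_apply, hvv, huv, hvu]
    module

theorem exists_smul_add_smul_of_ne {u v : V} (hu : u ≠ 0) (hv : v ≠ 0) (hvu : v ≠ u) (w : V) :
    ∃ p q : F2, w = p • u + q • v :=
  have ⟨x, hx⟩ := (bijective_combination_of_ne hu hv hvu).2 w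
  ⟨x.1, x.2, hx.symm⟩

theorem exists_isIso_salgT_of_not_curled {μ : Mul2} (hμ : ¬ Curled μ) :
    ∃ t, IsIso (SalgT t) μ := by
  simp only [Curled, not_forall, not_exists] at hμ
  obtain ⟨u, hu⟩ := hμ
  have h0 : μ u u ≠ 0 := by simpa using hu 0
  have h1 : μ u u ≠ u := by simpa using hu 1
  have hu0 : u ≠ 0 := by rintro rfl; simp at h0
  have hspan := exists_smul_add_smul_of_ne hu0 h0 h1
  obtain ⟨p, q, hvv⟩ := hspan (μ (μ u u) (μ u u))
  obtain ⟨a, b, huv⟩ := hspan (μ u (μ u u))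
  obtain ⟨c, d, hvu⟩ := hspan (μ (μ u u) u)
  exact ⟨(p, q, a, b, c, d), (isIso_salgT_iff _ _).2 ⟨u, h0, h1, hvv, huv, hvu⟩⟩

theorem exists_mem_ecsList_generator (t : F2 × F2 × F2 × F2 × F2 × F2)
    (ht : EndoCommutative (SalgT t)) :
    ∃ t' ∈ ecsList, ∃ u, IsStraightGenerator t' (SalgT t) u := by
  simp only [EndoCommutative, IsStraightGenerator, salgT_apply] at ht ⊢
  revert t
  decide +kernel

theorem not_isStraightGenerator_of_mem_ecsList :
    ∀ t ∈ ecsList, ∀ t' ∈ ecsList, t ≠ t' →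
      ¬ ∃ u, IsStraightGenerator t (SalgT t') u := by
  simp only [IsStraightGenerator, salgT_apply]
  decide +kernel

/-- Classification: the thirteen listed algebras `S(p,q,a,b,c,d)` are endo-commutative
and straight (i.e. not curled), every two-dimensional endo-commutative straight algebra
over `F₂` is isomorphic to one of them, and no two of them are isomorphic. -/
theorem ecStraight_classification :
    (∀ t ∈ ecsList, EndoCommutative (SalgT t) ∧ ¬ Curled (SalgT t)) ∧
    (∀ μ : Mul2, EndoCommutative μ → ¬ Curled μ → ∃ t ∈ ecsList, IsIso μ (SalgT t)) ∧
    (∀ t ∈ ecsList, ∀ t' ∈ ecsList, t ≠ t' → ¬ IsIso (SalgT t) (SalgT t')) := by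
  refine ⟨?_, fun μ hμ hc => ?_, fun t ht t' ht' hne h => ?_⟩
  · simp only [EndoCommutative, Curled, salgT_apply]
    decide +kernel
  · obtain ⟨t, h⟩ := exists_isIso_salgT_of_not_curled hc
    obtain ⟨t', ht', hu⟩ := exists_mem_ecsList_generator t (h.endoCommutative hμ)
    exact ⟨t', ht', (((isIso_salgT_iff t' _).2 hu).trans h).symm⟩
  · exact not_isStraightGenerator_of_mem_ecsList t ht t' ht' hne ((isIso_salgT_iff t _).1 h)
end
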